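/- Let L ∈ B(H,G) satisfy 0 < ‖L‖ ≤ 1, let g : G → (−∞,+∞] be proper with a continuous affine minorant, and let γ > 0. Then: (i) prox_{γ (L ⊙_γ g)} = L* ∘ prox_{γ g**} ∘ L; (ii) prox_{γ (L ⊚_γ g)} = Id_H − L* ∘ (Id_G − prox_{γ g**}) ∘ L. -/

import Mathlib

open scoped RealInnerProductSpace
open Filter Set

noncomputable section

/-- Fenchel (Legendre) conjugate of an extended-real-valued function. -/
def fconj {H : Type*} [NormedAddCommGroup H] [InnerProductSpace ℝ H]
    (f : H → EReal) : H → EReal :=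
  fun xs => ⨆ x : H, (⟪x, xs⟫ : EReal) - f x

/-- Moreau envelope of index `γ`. -/
def menv {H : Type*} [NormedAddCommGroup H] (γ : ℝ) (f : H → EReal) : H → EReal :=
  fun x => ⨅ y : H, f y + ((‖x - y‖ ^ 2 / (2 * γ) : ℝ) : EReal)

/-- Quadratic kernel `Q`. -/
def qk {H : Type*} [NormedAddCommGroup H] (x : H) : ℝ := ‖x‖ ^ 2 / 2

/-- Proximal composition `L ⊙_γ g`. -/
def proxComp {H G : Type*} [NormedAddCommGroup H] [InnerProductSpace ℝ H]
    [NormedAddCommGroup G] [InnerProductSpace ℝ G]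
    (L : H →L[ℝ] G) (γ : ℝ) (g : G → EReal) : H → EReal :=
  fun x => fconj (fun z => menv (1 / γ) (fconj g) (L z)) x - (((1 / γ) * qk x : ℝ) : EReal)

/-- Proximal cocomposition `L ⊚_γ g`. -/
def proxCocomp {H G : Type*} [NormedAddCommGroup H] [InnerProductSpace ℝ H]
    [NormedAddCommGroup G] [InnerProductSpace ℝ G]
    (L : H →L[ℝ] G) (γ : ℝ) (g : G → EReal) : H → EReal :=
  fconj (proxComp L (1 / γ) (fconj g))

/-- `f` is proper: not identically `+∞` and never `−∞`. -/
def ProperE {H : Type*} (f : H → EReal) : Prop :=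
  (∃ x, f x ≠ ⊤) ∧ ∀ x, f x ≠ ⊥

/-- `f` admits a continuous affine minorant. -/
def HasAffMinorant {H : Type*} [NormedAddCommGroup H] [InnerProductSpace ℝ H]
    (f : H → EReal) : Prop :=
  ∃ (u : H) (c : ℝ), ∀ x, ((⟪x, u⟫ + c : ℝ) : EReal) ≤ f x

/-- Convexity for extended-real-valued functions. -/
def ConvexE {H : Type*} [NormedAddCommGroup H] [InnerProductSpace ℝ H]
    (f : H → EReal) : Prop :=
  ∀ x y : H, ∀ a b : ℝ, 0 < a → 0 < b → a + b = 1 →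
    f (a • x + b • y) ≤ ((a : ℝ) : EReal) * f x + ((b : ℝ) : EReal) * f y

/-- The class `Γ₀`: proper, lower semicontinuous, convex. -/
def IsGamma0 {H : Type*} [NormedAddCommGroup H] [InnerProductSpace ℝ H]
    (f : H → EReal) : Prop :=
  ProperE f ∧ LowerSemicontinuous f ∧ ConvexE f

/-- `p` is a proximal point of `f` at `x`. -/
def IsProx {H : Type*} [NormedAddCommGroup H] (f : H → EReal) (x p : H) : Prop :=
  ∀ y : H, f p + ((‖x - p‖ ^ 2 / 2 : ℝ) : EReal) ≤ f y + ((‖x - y‖ ^ 2 / 2 : ℝ) : EReal)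

/-- Subdifferential. -/
def SubdiffE {H : Type*} [NormedAddCommGroup H] [InnerProductSpace ℝ H]
    (f : H → EReal) (x : H) : Set H :=
  {xs | ∀ y : H, (⟪y - x, xs⟫ : EReal) + f x ≤ f y}

/-- Recession function. -/
def recE {H : Type*} [NormedAddCommGroup H] (f : H → EReal) : H → EReal :=
  fun x => ⨆ y : {y : H // f y ≠ ⊤}, f (x + (y : H)) - f (y : H)

end

/-- `s` is a subgradient of `f` at `x`, where `f` takes the finite value `r`. -/
def HasSubgradientAt {H : Type*} [NormedAddCommGroup H] [InnerProductSpace ℝ H]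
    (f : H → EReal) (x s : H) (r : ℝ) : Prop :=
  f x = r ∧ ∀ y : H, ((r + ⟪y - x, s⟫ : ℝ) : EReal) ≤ f y

section Conjugate

variable {H : Type*} [NormedAddCommGroup H] [InnerProductSpace ℝ H]

theorem coe_sub_le_coe_iff (a t : ℝ) (x : EReal) :
    (a : EReal) - x ≤ t ↔ ∀ c : ℝ, x ≤ c → a - c ≤ t := by
  induction x with
  | bot =>
    simp only [EReal.coe_sub_bot, top_le_iff, EReal.coe_ne_top, bot_le, forall_const, false_iff,
      not_forall]
    exact ⟨a - t - 1, by linarith⟩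
  | top => simp
  | coe b =>
    norm_cast
    exact ⟨fun h c hc => by linarith, fun h => h b le_rfl⟩

theorem fconj_le_coe_iff (f : H → EReal) (v : H) (t : ℝ) :
    fconj f v ≤ t ↔ ∀ (y : H) (c : ℝ), f y ≤ c → ⟪y, v⟫ - c ≤ t := by
  simp only [fconj, iSup_le_iff, coe_sub_le_coe_iff]

theorem fconj_fconj_le (f : H → EReal) (x : H) : fconj (fconj f) x ≤ f x := by
  refine EReal.le_of_forall_lt_iff_le.1 fun z hz => ?_
  rw [fconj_le_coe_iff]
  intro y c hc
  rw [fconj_le_coe_iff] at hc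
  have := hc x z hz.le
  rw [real_inner_comm]
  linarith

theorem fconj_antitone {f g : H → EReal} (h : ∀ x, f x ≤ g x) (v : H) :
    fconj g v ≤ fconj f v :=
  iSup_mono fun x => EReal.sub_le_sub le_rfl (h x)

theorem fconj_fconj_fconj (f : H → EReal) : fconj (fconj (fconj f)) = fconj f :=
  funext fun x => le_antisymm (fconj_fconj_le _ x) (fconj_antitone (fconj_fconj_le f) x)

/-- A continuous affine minorant of a function also minorizes its biconjugate. -/
theorem affine_le_fconj_fconj {f : H → EReal} {u : H} {c : ℝ}
    (h : ∀ x, ((⟪x, u⟫ + c : ℝ) : EReal) ≤ f x) (x : H) :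
    ((⟪x, u⟫ + c : ℝ) : EReal) ≤ fconj (fconj f) x := by
  refine EReal.le_of_forall_lt_iff_le.1 fun z hz => ?_
  have hu : fconj f u ≤ ((-c : ℝ) : EReal) := by
    rw [fconj_le_coe_iff]
    intro y d hd
    have := EReal.coe_le_coe_iff.1 ((h y).trans hd)
    linarith
  have := (fconj_le_coe_iff _ _ _).1 hz.le u (-c) hu
  rw [real_inner_comm] at this
  exact EReal.coe_le_coe_iff.2 (by linarith)

theorem HasSubgradientAt.conjugate {f : H → EReal} {x s : H} {r : ℝ}
    (h : HasSubgradientAt f x s r) : HasSubgradientAt (fconj f) s x (⟪x, s⟫ - r) := by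
  have key : ∀ y : H, ((⟪x, y⟫ - r : ℝ) : EReal) ≤ fconj f y := fun y => by
    have := le_iSup (fun z : H => (⟪z, y⟫ : EReal) - f z) x
    rwa [h.1, ← EReal.coe_sub] at this
  refine ⟨le_antisymm ?_ (key s), fun y => ?_⟩
  · rw [fconj_le_coe_iff]
    intro y c hc
    have := EReal.coe_le_coe_iff.1 ((h.2 y).trans hc)
    rw [inner_sub_left] at this
    linarith
  · convert key y using 2
    rw [inner_sub_left, real_inner_comm x y, real_inner_comm x s]
    ring

/-- If `(x - P) / γ` is a subgradient of `f` at `P`, then `P` is the unique proximal point of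
`γ f` at `x`. -/
theorem HasSubgradientAt.isProx_iff {f : H → EReal} {P s : H} {r : ℝ}
    (h : HasSubgradientAt f P s r) {γ : ℝ} (hγ : 0 < γ) {x : H} (hx : x = P + γ • s) (p : H) :
    IsProx (fun z => (γ : EReal) * f z) x p ↔ p = P := by
  have expand : ∀ y : H, ‖x - y‖ ^ 2 = ‖x - P‖ ^ 2 - 2 * (γ * ⟪y - P, s⟫) + ‖y - P‖ ^ 2 := by
    intro y
    have h1 : x - y = (x - P) - (y - P) := by abel
    have h2 : x - P = γ • s := by rw [hx]; abel
    rw [h1, norm_sub_sq_real, h2, real_inner_smul_left, real_inner_comm]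
  constructor
  · intro hp
    have h1 := hp P
    have h2 := h.2 p
    simp only [h.1] at h1
    generalize f p = t at h1 h2
    induction t with
    | bot => simp at h2
    | top =>
      rw [EReal.coe_mul_top_of_pos hγ, EReal.top_add_coe, ← EReal.coe_mul, ← EReal.coe_add,
        top_le_iff] at h1
      exact absurd h1 (EReal.coe_ne_top _)
    | coe t =>
      norm_cast at h1 h2
      rw [expand p] at h1
      have h3 := mul_le_mul_of_nonneg_left h2 hγ.le
      have h4 : ‖p - P‖ ^ 2 ≤ 0 := by linarith
      exact sub_eq_zero.1 (norm_eq_zero.1 (pow_eq_zero_iff two_ne_zero |>.1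
        (le_antisymm h4 (sq_nonneg _))))
  · rintro rfl y
    have h2 := h.2 y
    simp only [h.1]
    generalize f y = t at h2
    induction t with
    | bot => simp at h2
    | top => rw [EReal.coe_mul_top_of_pos hγ, EReal.top_add_coe]; exact le_top
    | coe t =>
      norm_cast at h2 ⊢
      rw [expand y]
      have h3 := mul_le_mul_of_nonneg_left h2 hγ.le
      linarith [sq_nonneg ‖y - p‖]

end Conjugate

section Existence

variable {G : Type*} [NormedAddCommGroup G] [InnerProductSpace ℝ G]

/-- The value `(v, t) ↦ t + ‖v - a‖² / (2γ)` improves quadratically at midpoints. -/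
theorem midpoint_value (a v w : G) (t s γ : ℝ) :
    ((1 / 2) * t + (1 / 2) * s) + ‖((1 / 2 : ℝ) • v + (1 / 2 : ℝ) • w) - a‖ ^ 2 / (2 * γ)
      = ((t + ‖v - a‖ ^ 2 / (2 * γ)) + (s + ‖w - a‖ ^ 2 / (2 * γ))) / 2
        - ‖v - w‖ ^ 2 / (8 * γ) := by
  have h1 : ((1 / 2 : ℝ) • v + (1 / 2 : ℝ) • w) - a = (1 / 2 : ℝ) • ((v - a) + (w - a)) := by
    module
  have h2 : v - w = (v - a) - (w - a) := by abel
  rw [h1, h2, norm_smul, mul_pow, norm_add_sq_real, norm_sub_sq_real (v - a)]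
  norm_num
  ring

/-- A closed convex set in `G × ℝ` on which `t + ‖v - a‖² / (2γ)` is bounded below contains
a minimizer of that function. -/
theorem exists_minimizer_of_isClosed_convex [CompleteSpace G] {E : Set (G × ℝ)} (hcl : IsClosed E)
    (hcv : Convex ℝ E) (hne : E.Nonempty) {γ : ℝ} (hγ : 0 < γ) (a : G) {b : ℝ}
    (hb : ∀ e ∈ E, b ≤ e.2 + ‖e.1 - a‖ ^ 2 / (2 * γ)) :
    ∃ e₀ ∈ E, ∀ e ∈ E, e₀.2 + ‖e₀.1 - a‖ ^ 2 / (2 * γ) ≤ e.2 + ‖e.1 - a‖ ^ 2 / (2 * γ) := by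
  set J : G × ℝ → ℝ := fun e => e.2 + ‖e.1 - a‖ ^ 2 / (2 * γ) with hJ
  set m := sInf (J '' E)
  have hbdd : BddBelow (J '' E) := ⟨b, by rintro _ ⟨e, he, rfl⟩; exact hb e he⟩
  have hmle : ∀ e ∈ E, m ≤ J e := fun e he => csInf_le hbdd ⟨e, he, rfl⟩
  have hex : ∀ n : ℕ, ∃ e ∈ E, J e < m + 1 / ((n : ℝ) + 1) := fun n => by
    obtain ⟨_, ⟨e, he, rfl⟩, h⟩ :=
      exists_lt_of_csInf_lt (hne.image J) (lt_add_of_pos_right m (Nat.one_div_pos_of_nat (n := n)))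
    exact ⟨e, he, h⟩
  choose e heE hlt using hex
  have hdist : ∀ k n : ℕ, ‖(e k).1 - (e n).1‖ ^ 2
      ≤ 4 * γ * (1 / ((k : ℝ) + 1) + 1 / ((n : ℝ) + 1)) := by
    intro k n
    have h1 := hmle _ (hcv (heE k) (heE n) (by norm_num : (0 : ℝ) ≤ 1 / 2)
      (by norm_num : (0 : ℝ) ≤ 1 / 2) (by norm_num))
    have h2 := midpoint_value a (e k).1 (e n).1 (e k).2 (e n).2 γ
    have h3 : m ≤ (J (e k) + J (e n)) / 2 - ‖(e k).1 - (e n).1‖ ^ 2 / (8 * γ) := by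
      rw [← h2]; exact h1
    have h4 : ‖(e k).1 - (e n).1‖ ^ 2 / (8 * γ)
        ≤ (1 / ((k : ℝ) + 1) + 1 / ((n : ℝ) + 1)) / 2 := by
      linarith [hlt k, hlt n]
    rw [div_le_iff₀ (by positivity)] at h4
    linarith
  have hcauchy : CauchySeq fun n => (e n).1 := by
    refine cauchySeq_of_le_tendsto_0 (fun N : ℕ => √(4 * γ * (1 / ((N : ℝ) + 1) +
      1 / ((N : ℝ) + 1)))) (fun k n N hk hn => ?_) ?_
    · rw [dist_eq_norm]
      refine Real.le_sqrt_of_sq_le ((hdist k n).trans ?_)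
      have := Nat.one_div_le_one_div (α := ℝ) hk
      have := Nat.one_div_le_one_div (α := ℝ) hn
      gcongr
    · have h0 := tendsto_one_div_add_atTop_nhds_zero_nat (𝕜 := ℝ)
      simpa using ((h0.add h0).const_mul (4 * γ)).sqrt
  obtain ⟨q, hq⟩ := cauchySeq_tendsto_of_complete hcauchy
  have hJlim : Tendsto (fun n => J (e n)) atTop (nhds m) := by
    refine tendsto_of_tendsto_of_tendsto_of_le_of_le tendsto_const_nhds
      (g := fun _ => m) (h := fun n : ℕ => m + 1 / ((n : ℝ) + 1)) ?_
      (fun n => hmle _ (heE n)) (fun n => (hlt n).le)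
    simpa using tendsto_const_nhds.add (tendsto_one_div_add_atTop_nhds_zero_nat (𝕜 := ℝ))
  have hlim2 : Tendsto (fun n => (e n).2) atTop (nhds (m - ‖q - a‖ ^ 2 / (2 * γ))) := by
    have := hJlim.sub ((((hq.sub_const a).norm).pow 2).div_const (2 * γ))
    simpa [hJ] using this
  refine ⟨(q, m - ‖q - a‖ ^ 2 / (2 * γ)), hcl.mem_of_tendsto (hq.prodMk_nhds hlim2)
    (Eventually.of_forall heE), fun e he => ?_⟩
  simpa using hmle e he

theorem le_of_isMinimizer_of_convex {E : Set (G × ℝ)} (hcv : Convex ℝ E) {γ : ℝ} (hγ : 0 < γ)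
    {a : G} {e₀ : G × ℝ} (h₀ : e₀ ∈ E)
    (hmin : ∀ e ∈ E, e₀.2 + ‖e₀.1 - a‖ ^ 2 / (2 * γ) ≤ e.2 + ‖e.1 - a‖ ^ 2 / (2 * γ))
    {e : G × ℝ} (he : e ∈ E) :
    e₀.2 + ⟪e.1 - e₀.1, γ⁻¹ • (a - e₀.1)⟫ ≤ e.2 := by
  set A := e.2 - e₀.2 - ⟪e.1 - e₀.1, γ⁻¹ • (a - e₀.1)⟫ with hA
  set B := ‖e.1 - e₀.1‖ ^ 2 / (2 * γ) with hB
  have key : ∀ l : ℝ, 0 < l → l ≤ 1 → 0 ≤ A + l * B := by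
    intro l hl hl1
    have h1 := hmin _ (hcv h₀ he (sub_nonneg.2 hl1) hl.le (by ring))
    simp only [Prod.fst_add, Prod.smul_fst, Prod.snd_add, Prod.smul_snd, smul_eq_mul] at h1
    have h2 : (1 - l) • e₀.1 + l • e.1 - a = l • (e.1 - e₀.1) - (a - e₀.1) := by module
    rw [h2, norm_sub_sq_real (l • _), norm_smul, real_inner_smul_left, mul_pow, Real.norm_eq_abs, sq_abs,
      norm_sub_rev a e₀.1] at h1
    have h3 : 0 ≤ l * (A + l * B) := by
      rw [hA, hB, real_inner_smul_right]
      have h4 : (l ^ 2 * ‖e.1 - e₀.1‖ ^ 2 - 2 * (l * ⟪e.1 - e₀.1, a - e₀.1⟫)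
          + ‖e₀.1 - a‖ ^ 2) / (2 * γ) = l * (l * (‖e.1 - e₀.1‖ ^ 2 / (2 * γ)))
          - l * (γ⁻¹ * ⟪e.1 - e₀.1, a - e₀.1⟫) + ‖e₀.1 - a‖ ^ 2 / (2 * γ) := by
        field_simp
      rw [h4] at h1
      linarith
    exact nonneg_of_mul_nonneg_right h3 hl
  have hlim : Tendsto (fun n : ℕ => A + 1 / ((n : ℝ) + 1) * B) atTop (nhds A) := by
    simpa using tendsto_const_nhds.add
      ((tendsto_one_div_add_atTop_nhds_zero_nat (𝕜 := ℝ)).mul_const B)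
  have hA0 : 0 ≤ A := ge_of_tendsto' hlim fun n => key _ Nat.one_div_pos_of_nat
    (by rw [div_le_one (by positivity)]; linarith [Nat.cast_nonneg (α := ℝ) n])
  linarith

theorem isClosed_epigraph_fconj (f : G → EReal) :
    IsClosed {e : G × ℝ | fconj f e.1 ≤ e.2} := by
  simp only [fconj_le_coe_iff, Set.ofPred_forall]
  exact isClosed_iInter fun y => isClosed_iInter fun c => isClosed_iInter fun _ =>
    isClosed_le (by fun_prop) (by fun_prop)

theorem convex_epigraph_fconj (f : G → EReal) :
    Convex ℝ {e : G × ℝ | fconj f e.1 ≤ e.2} := by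
  simp only [fconj_le_coe_iff]
  intro d hd e he a b ha hb hab y c hc
  have h1 := mul_le_mul_of_nonneg_left (hd y c hc) ha
  have h2 := mul_le_mul_of_nonneg_left (he y c hc) hb
  simp only [Prod.fst_add, Prod.smul_fst, Prod.snd_add, Prod.smul_snd, smul_eq_mul,
    inner_add_right, real_inner_smul_right]
  have h3 : c = a * c + b * c := by rw [← add_mul, hab, one_mul]
  linarith

/-- Resolvent equation for the subdifferential of a proper conjugate function. -/
theorem exists_hasSubgradientAt_fconj [CompleteSpace G] {f : G → EReal} {x₀ : G} (hx₀ : fconj f x₀ ≠ ⊤)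
    (hm : HasAffMinorant (fconj f)) {γ : ℝ} (hγ : 0 < γ) (a : G) :
    ∃ (q s : G) (r : ℝ), HasSubgradientAt (fconj f) q s r ∧ a = q + γ • s := by
  obtain ⟨u, c, hc⟩ := hm
  have hbot : ∀ x, fconj f x ≠ ⊥ := fun x h => by simpa [h] using hc x
  obtain ⟨e₀, h₀, hmin⟩ := exists_minimizer_of_isClosed_convex (isClosed_epigraph_fconj f)
    (convex_epigraph_fconj f) ⟨(x₀, (fconj f x₀).toReal), EReal.le_coe_toReal hx₀⟩ hγ a
    (b := ⟪a, u⟫ + c - γ * ‖u‖ ^ 2 / 2) (by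
      rintro ⟨v, t⟩ hvt
      have h1 : ⟪v, u⟫ + c ≤ t := EReal.coe_le_coe_iff.1 ((hc v).trans hvt)
      have h2 : 0 ≤ ‖(v - a) + γ • u‖ ^ 2 / (2 * γ) := by positivity
      have h3 : ‖(v - a) + γ • u‖ ^ 2 / (2 * γ)
          = ‖v - a‖ ^ 2 / (2 * γ) + (⟪v, u⟫ - ⟪a, u⟫) + γ * ‖u‖ ^ 2 / 2 := by
        rw [norm_add_sq_real, real_inner_smul_right, norm_smul, inner_sub_left, mul_pow,
          Real.norm_eq_abs, sq_abs]
        field_simp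
      simp only
      linarith)
  have hsub := fun (v : G) (t : ℝ) (h : fconj f v ≤ t) =>
    le_of_isMinimizer_of_convex (convex_epigraph_fconj f) hγ h₀ hmin (e := (v, t)) h
  refine ⟨e₀.1, γ⁻¹ • (a - e₀.1), e₀.2, ⟨le_antisymm h₀ ?_, fun y => ?_⟩, ?_⟩
  · refine EReal.le_of_forall_lt_iff_le.1 fun z hz => ?_
    simpa using hsub e₀.1 z hz.le
  · refine EReal.le_of_forall_lt_iff_le.1 fun z hz => ?_
    exact EReal.coe_le_coe_iff.2 (hsub y z hz.le)
  · rw [smul_inv_smul₀ hγ.ne']; abel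

end Existence

section Envelope

theorem menv_le_of_eq {G : Type*} [NormedAddCommGroup G] {f : G → EReal} {w : G} {r : ℝ} (h : f w = r) (μ : ℝ) (v : G) :
    menv μ f v ≤ ((r + ‖v - w‖ ^ 2 / (2 * μ) : ℝ) : EReal) := by
  have := iInf_le (fun y => f y + ((‖v - y‖ ^ 2 / (2 * μ) : ℝ) : EReal)) w
  rwa [h, ← EReal.coe_add] at this

variable {G : Type*} [NormedAddCommGroup G] [InnerProductSpace ℝ G]

/-- The Moreau envelope lies above its tangent at `w + μ s`. -/
theorem HasSubgradientAt.le_menv {f : G → EReal} {w s : G} {r : ℝ}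
    (h : HasSubgradientAt f w s r) {μ : ℝ} (hμ : 0 < μ) (v : G) :
    ((r + ⟪v - w, s⟫ - μ * ‖s‖ ^ 2 / 2 : ℝ) : EReal) ≤ menv μ f v := by
  refine le_iInf fun y => le_trans ?_ (add_le_add_left (h.2 y) _)
  rw [← EReal.coe_add, EReal.coe_le_coe_iff]
  have h1 : 0 ≤ ‖(v - y) - μ • s‖ ^ 2 / (2 * μ) := by positivity
  have h2 : ‖(v - y) - μ • s‖ ^ 2 / (2 * μ)
      = ‖v - y‖ ^ 2 / (2 * μ) - ⟪v - y, s⟫ + μ * ‖s‖ ^ 2 / 2 := by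
    rw [norm_sub_sq_real, real_inner_smul_right, norm_smul, mul_pow, Real.norm_eq_abs, sq_abs]
    field_simp
  have h3 : ⟪v - w, s⟫ = ⟪v - y, s⟫ + ⟪y - w, s⟫ := by
    rw [← inner_add_left, sub_add_sub_cancel]
  linarith

variable {H : Type*} [NormedAddCommGroup H] [InnerProductSpace ℝ H] [CompleteSpace H]
  [CompleteSpace G]

/-- A subgradient of `g*` whose resolvent point lies in the range of `L` yields a subgradient of
the proximal composition. -/
theorem HasSubgradientAt.proximalComposition {L : H →L[ℝ] G} (hL : ‖L‖ ≤ 1) {g : G → EReal} {γ : ℝ}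
    (hγ : 0 < γ) {w s : G} {r : ℝ} (h : HasSubgradientAt (fconj g) w s r) {z : H}
    (hz : L z = w + (1 / γ) • s) :
    ∃ c : ℝ, HasSubgradientAt (proxComp L γ g) (ContinuousLinearMap.adjoint L s)
      (z - (1 / γ) • ContinuousLinearMap.adjoint L s) c := by
  set p := ContinuousLinearMap.adjoint L s
  set μ := 1 / γ with hμd
  have hμ : 0 < μ := one_div_pos.2 hγ
  have hadj : ∀ x : H, ⟪x, p⟫ = ⟪L x, s⟫ := fun x =>
    ContinuousLinearMap.adjoint_inner_right L x s
  set c₀ := ⟪z, p⟫ - r - μ * ‖s‖ ^ 2 / 2 with hc₀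
  have lower : ∀ y : H, ((c₀ + ⟪y - p, z⟫ + μ * ‖y - p‖ ^ 2 / 2 : ℝ) : EReal)
      ≤ fconj (fun z => menv μ (fconj g) (L z)) y := by
    intro y
    refine le_trans ?_ (le_iSup (fun x : H => (⟪x, y⟫ : EReal) -
      menv μ (fconj g) (L x)) (z + μ • (y - p)))
    refine le_trans ?_ (EReal.sub_le_sub le_rfl (menv_le_of_eq h.1 μ _))
    rw [← EReal.coe_sub, EReal.coe_le_coe_iff]
    have h1 : L (z + μ • (y - p)) - w = μ • (L (y - p) + s) := by
      rw [map_add, map_smul, hz]; module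
    have h2 : ‖L (y - p)‖ ^ 2 ≤ ‖y - p‖ ^ 2 := by
      gcongr
      exact (L.le_of_opNorm_le hL _).trans (one_mul _).le
    have h3 : ‖μ • (L (y - p) + s)‖ ^ 2 / (2 * μ)
        = μ * ‖L (y - p)‖ ^ 2 / 2 + μ * ⟪y - p, p⟫ + μ * ‖s‖ ^ 2 / 2 := by
      rw [norm_smul, mul_pow, Real.norm_eq_abs, sq_abs, norm_add_sq_real, ← hadj]
      field_simp
    have h4 : μ * ‖L (y - p)‖ ^ 2 / 2 ≤ μ * ‖y - p‖ ^ 2 / 2 := by gcongr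
    have h5 : ⟪z + μ • (y - p), y⟫
        = ⟪z, p⟫ + ⟪y - p, z⟫ + μ * ‖y - p‖ ^ 2 + μ * ⟪y - p, p⟫ := by
      rw [inner_add_left, real_inner_smul_left, ← real_inner_self_eq_norm_sq]
      simp only [inner_sub_left, inner_sub_right, real_inner_comm]
      ring
    rw [h1, h3, h5]
    linarith
  have upper : fconj (fun z => menv μ (fconj g) (L z)) p ≤ c₀ := by
    refine iSup_le fun x => (EReal.sub_le_sub le_rfl (h.le_menv hμ (L x))).trans ?_
    rw [← EReal.coe_sub, EReal.coe_le_coe_iff, hc₀, hadj, hadj, hz, inner_sub_left,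
      inner_add_left, real_inner_smul_left, real_inner_self_eq_norm_sq]
    linarith
  have value : fconj (fun z => menv μ (fconj g) (L z)) p = c₀ :=
    le_antisymm upper (by simpa using lower p)
  refine ⟨c₀ - μ * qk p, ?_, fun y => ?_⟩
  · simp only [proxComp, ← hμd, value, EReal.coe_sub]
  · refine le_trans ?_ (EReal.sub_le_sub (lower y) le_rfl)
    rw [← EReal.coe_sub, EReal.coe_le_coe_iff]
    have h1 : ‖y - p‖ ^ 2 = ‖y‖ ^ 2 - 2 * ⟪y, p⟫ + ‖p‖ ^ 2 := norm_sub_sq_real y p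
    rw [inner_sub_right, real_inner_smul_right, h1, qk, qk, inner_sub_left y p p,
      real_inner_self_eq_norm_sq]
    linarith

end Envelope

/-- `prox_{γ(L ⊙_γ g)} = L* ∘ prox_{γ g**} ∘ L` and
`prox_{γ(L ⊚_γ g)} = Id_H − L* ∘ (Id_G − prox_{γ g**}) ∘ L`, stated via the
characterization of proximal points (which are unique for `Γ₀` functions). -/
theorem prox_of_proxComp_and_proxCocomp
    {H G : Type*} [NormedAddCommGroup H] [InnerProductSpace ℝ H] [CompleteSpace H]
    [NormedAddCommGroup G] [InnerProductSpace ℝ G] [CompleteSpace G]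
    (L : H →L[ℝ] G) (hL0 : 0 < ‖L‖) (hL1 : ‖L‖ ≤ 1)
    (g : G → EReal) (hg : ProperE g) (hm : HasAffMinorant g)
    (γ : ℝ) (hγ : 0 < γ) :
    (∀ (x p : H), IsProx (fun z : H => ((γ : ℝ) : EReal) * proxComp L γ g z) x p ↔
        ∃ q : G, IsProx (fun y : G => ((γ : ℝ) : EReal) * fconj (fconj g) y) (L x) q ∧
          p = ContinuousLinearMap.adjoint L q) ∧
    (∀ (x p : H), IsProx (fun z : H => ((γ : ℝ) : EReal) * proxCocomp L γ g z) x p ↔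
        ∃ q : G, IsProx (fun y : G => ((γ : ℝ) : EReal) * fconj (fconj g) y) (L x) q ∧
          p = x - ContinuousLinearMap.adjoint L (L x - q)) := by
  obtain ⟨x₀, hx₀⟩ := hg.1
  obtain ⟨u, c, hc⟩ := hm
  have hres : ∀ x : H, ∃ (q s : G) (r : ℝ),
      HasSubgradientAt (fconj (fconj g)) q s r ∧ L x = q + γ • s := fun x =>
    exists_hasSubgradientAt_fconj (ne_top_of_le_ne_top hx₀ (fconj_fconj_le g x₀))
      ⟨u, c, affine_le_fconj_fconj hc⟩ hγ (L x)
  refine ⟨fun x p => ?_, fun x p => ?_⟩ <;> obtain ⟨q, s, r, hsub, hx⟩ := hres x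
  · have hsub' := hsub.conjugate
    rw [fconj_fconj_fconj] at hsub'
    obtain ⟨d, hd⟩ := hsub'.proximalComposition hL1 hγ (z := (1 / γ) • x) (by
      rw [map_smul, hx, smul_add, one_div, inv_smul_smul₀ hγ.ne', add_comm])
    rw [hd.isProx_iff hγ (by
      rw [one_div, smul_sub, smul_inv_smul₀ hγ.ne', smul_inv_smul₀ hγ.ne']; abel)]
    simp only [hsub.isProx_iff hγ hx, exists_eq_left]
  · obtain ⟨d, hd⟩ := hsub.proximalComposition hL1 (one_div_pos.2 hγ) (z := x) (by rwa [one_div_one_div])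
    rw [one_div_one_div] at hd
    rw [proxCocomp, hd.conjugate.isProx_iff hγ (sub_add_cancel _ _).symm]
    simp only [hsub.isProx_iff hγ hx, exists_eq_left]
    rw [hx, add_sub_cancel_left, map_smul]
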